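/- arXiv:1304.7274 — 2 statements merged into one kernel-verified Lean document; each statement's English description precedes it below -/
import Mathlib

section
/- Let $m, n, q$ be positive integers. The number of staircase $m \times n$ matrices $(p_{i,j})$ of non-negative integers such that $\sum_{j=1}^n p_{i,j} \le q-1$ for every row index $i$ and such that some column sum $\sum_{i=1}^m p_{i,j}$ is at least $q$, equals $\sum_{i=1}^{n}\sum_{j=1}^{m} (-1)^{m-j+i-1}\binom{n}{i}\binom{m}{j}\binom{jq - iq + n - 1}{m+n-1}$ (the same double sum with the $j=0$ terms omitted). -/
/-- An `m × n` matrix of non-negative integers is staircase if whenever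
`p i j > 0`, `i' < i` and `j < j'`, then `p i' j' = 0`. -/
def IsStaircase {m n : ℕ} (p : Fin m → Fin n → ℕ) : Prop :=
  ∀ i i' : Fin m, ∀ j j' : Fin n, 0 < p i j → i' < i → j < j' → p i' j' = 0

/-- Binomial coefficient of an integer `t` over a natural `b`, with the
convention that it is `0` whenever `t < b` (in particular whenever `t < 0`). -/
def ichoose (t : ℤ) (b : ℕ) : ℤ :=
  if t < (b : ℤ) then 0 else ((t.toNat.choose b : ℕ) : ℤ)


section

open Finset

/-- The sum of the entries of `p` in the first `a` rows and the first `b` columns. -/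
def cornerSum {m n : ℕ} (p : Fin m → Fin n → ℕ) (a b : ℕ) : ℕ :=
  ∑ i, ∑ j, if i.val < a ∧ j.val < b then p i j else 0

/-- The sum of the first `a` values of `r`. -/
def initSum {m : ℕ} (r : Fin m → ℕ) (a : ℕ) : ℕ :=
  ∑ i, if i.val < a then r i else 0

lemma initSum_succ {m : ℕ} (r : Fin m → ℕ) (i : Fin m) :
    initSum r (i + 1) = initSum r i + r i := by
  have h : r i = ∑ k, if k = i then r k else 0 := by simp
  rw [initSum, initSum, h, ← sum_add_distrib]
  refine sum_congr rfl fun k _ => ?_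
  grind

lemma initSum_zero {m : ℕ} (r : Fin m → ℕ) : initSum r 0 = 0 := by
  simp [initSum]

lemma initSum_self {m : ℕ} (r : Fin m → ℕ) : initSum r m = ∑ i, r i := by
  simp [initSum]

lemma initSum_mono {m : ℕ} (r : Fin m → ℕ) : Monotone (initSum r) := by
  intro a b hab
  refine sum_le_sum fun i _ => ?_
  grind

lemma cornerSum_eq_initSum {m n : ℕ} (p : Fin m → Fin n → ℕ) (a b : ℕ) :
    cornerSum p a b = initSum (fun i => initSum (p i) b) a := by
  unfold cornerSum initSum
  refine sum_congr rfl fun i _ => ?_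
  by_cases h : i.val < a <;> simp [h]

lemma cornerSum_add_apply {m n : ℕ} (p : Fin m → Fin n → ℕ) (i : Fin m) (j : Fin n) :
    cornerSum p (i + 1) (j + 1) + cornerSum p i j =
      cornerSum p i (j + 1) + cornerSum p (i + 1) j + p i j := by
  simp only [cornerSum_eq_initSum]
  rw [initSum_succ, initSum_succ, initSum_succ (fun k => initSum (p k) j)]
  ring

lemma IsStaircase.cornerSum_eq_min {m n : ℕ} {p : Fin m → Fin n → ℕ} (hp : IsStaircase p)
    (a b : ℕ) :
    cornerSum p a b =
      min (initSum (fun i => ∑ j, p i j) a) (initSum (fun j => ∑ i, p i j) b) := by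
  have hrow : initSum (fun i => ∑ j, p i j) a =
      cornerSum p a b + ∑ i, ∑ j, if i.val < a ∧ b ≤ j.val then p i j else 0 := by
    simp only [initSum, cornerSum, ← sum_add_distrib]
    refine sum_congr rfl fun i _ => ?_
    by_cases h : i.val < a
    · simp only [h, if_true, true_and]
      exact sum_congr rfl fun j _ => by grind
    · simp [h]
  have hcol : initSum (fun j => ∑ i, p i j) b =
      cornerSum p a b + ∑ i, ∑ j, if a ≤ i.val ∧ j.val < b then p i j else 0 := by
    simp only [initSum, cornerSum, ← sum_add_distrib]
    rw [sum_comm]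
    refine sum_congr rfl fun j _ => ?_
    by_cases h : j.val < b
    · simp only [h, if_true, and_true]
      exact sum_congr rfl fun i _ => by grind
    · simp [h]
  by_cases h : ∑ i, ∑ j, (if i.val < a ∧ b ≤ j.val then p i j else 0) = 0
  · omega
  · suffices ∑ i, ∑ j, (if a ≤ i.val ∧ j.val < b then p i j else 0) = 0 by omega
    obtain ⟨i', -, hi'⟩ := exists_ne_zero_of_sum_ne_zero h
    obtain ⟨j', -, hj'⟩ := exists_ne_zero_of_sum_ne_zero hi'
    refine sum_eq_zero fun i _ => sum_eq_zero fun j _ => ?_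
    by_contra hij
    have h1 : i'.val < a ∧ b ≤ j'.val ∧ p i' j' ≠ 0 := by grind
    have h2 : a ≤ i.val ∧ j.val < b ∧ p i j ≠ 0 := by grind
    exact h1.2.2 (hp i i' j j' (Nat.pos_of_ne_zero h2.2.2) (Fin.lt_def.2 (by omega))
      (Fin.lt_def.2 (by omega)))

/-- A staircase matrix is determined by its row sums and column sums. -/
lemma IsStaircase.ext_of_sums {m n : ℕ} {p p' : Fin m → Fin n → ℕ} (hp : IsStaircase p)
    (hp' : IsStaircase p') (hrow : ∀ i, ∑ j, p i j = ∑ j, p' i j)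
    (hcol : ∀ j, ∑ i, p i j = ∑ i, p' i j) : p = p' := by
  have h : ∀ a b, cornerSum p a b = cornerSum p' a b := fun a b => by
    rw [hp.cornerSum_eq_min, hp'.cornerSum_eq_min, funext hrow, funext hcol]
  ext i j
  have h1 := cornerSum_add_apply p i j
  have h2 := cornerSum_add_apply p' i j
  simp only [h] at h1
  omega

/-- The cells of a partition into consecutive intervals meet `[a, b]` in total length `b - a`. -/
lemma sum_interval_inter {n : ℕ} (c : Fin n → ℕ) {a b : ℕ} (hab : a ≤ b)
    (hb : b ≤ ∑ j, c j) :
    ∑ j : Fin n, (min b (initSum c (j + 1)) - max a (initSum c j)) = b - a := by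
  have key : ∀ N, ∑ j ∈ range N, (min b (initSum c (j + 1)) - max a (initSum c j)) =
      max a (min b (initSum c N)) - a := by
    intro N
    induction N with
    | zero => simp [initSum_zero]
    | succ N ih =>
      rw [sum_range_succ, ih]
      have := initSum_mono c (Nat.le_succ N)
      simp only [Nat.succ_eq_add_one] at this
      omega
  rw [Fin.sum_univ_eq_sum_range (fun j => min b (initSum c (j + 1)) - max a (initSum c j)), key,
    initSum_self]
  omega

/-- The northwest corner rule: any row sums and column sums of equal total are attained by a
staircase matrix. -/
lemma exists_isStaircase {m n : ℕ} (r : Fin m → ℕ) (c : Fin n → ℕ)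
    (h : ∑ i, r i = ∑ j, c j) :
    ∃ p : Fin m → Fin n → ℕ, IsStaircase p ∧ (∀ i, ∑ j, p i j = r i) ∧
      ∀ j, ∑ i, p i j = c j := by
  have hle {k : ℕ} (s : Fin k → ℕ) (i : Fin k) : initSum s (i + 1) ≤ ∑ i, s i := by
    rw [← initSum_self]
    exact initSum_mono s i.isLt
  refine ⟨fun i j => min (initSum r (i + 1)) (initSum c (j + 1)) -
    max (initSum r i) (initSum c j), ?_, ?_, ?_⟩
  · intro i i' j j' hpos hi hj
    have h1 := initSum_mono r (show i'.val + 1 ≤ i from hi)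
    have h2 := initSum_mono c (show j.val + 1 ≤ j' from hj)
    dsimp only at hpos ⊢
    omega
  · intro i
    rw [sum_interval_inter c (initSum_mono r (Nat.le_succ _)) (h ▸ hle r i), initSum_succ]
    omega
  · intro j
    simp only [min_comm _ (initSum c (j + 1)), max_comm _ (initSum c j)]
    rw [sum_interval_inter r (initSum_mono c (Nat.le_succ _)) (h ▸ hle c j), initSum_succ]
    omega

open PowerSeries in
/-- The functions with prescribed total and pointwise restricted values are counted by a coefficient
of a product of indicator power series. -/
lemma ncard_sum_eq_coeff_prod {ι : Type*} [Fintype ι] [DecidableEq ι] (s : ι → ℕ → Prop)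
    [∀ k, DecidablePred (s k)] (d : ℕ) :
    (({l : ι → ℕ | ∑ k, l k = d ∧ ∀ k, s k (l k)}.ncard : ℕ) : ℤ) =
      coeff d (∏ k, (mk fun a => if s k a then (1 : ℤ) else 0)) := by
  rw [coeff_prod]
  simp only [coeff_mk, prod_boole, mem_univ, true_imp_iff]
  rw [sum_boole, ← Set.ncard_coe_finset]
  congr 1
  refine Set.ncard_congr (fun l _ => Finsupp.equivFunOnFinite.symm l) ?_ ?_ ?_
  · intro l hl
    simpa using hl
  · intro l l' _ _ h
    exact Finsupp.equivFunOnFinite.symm.injective h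
  · intro l hl
    exact ⟨l, by simpa using hl, by simp⟩

lemma finite_sum_eq {ι : Type*} [Fintype ι] [DecidableEq ι] (d : ℕ) (s : (ι → ℕ) → Prop) :
    {l : ι → ℕ | ∑ k, l k = d ∧ s l}.Finite :=
  (piAntidiag univ d).finite_toSet.subset fun l hl => by simpa using hl.1

/-- Recording the complements of the row sums and the column sums identifies the staircase matrices
with bounded row sums and a large column sum with certain functions of fixed total. -/
lemma ncard_staircase_eq (m n q : ℕ) (hq : 0 < q) :
    {p : Fin m → Fin n → ℕ | IsStaircase p ∧ (∀ i : Fin m, ∑ j, p i j ≤ q - 1) ∧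
        ∃ j : Fin n, q ≤ ∑ i, p i j}.ncard =
      {l : Fin m ⊕ Fin n → ℕ | ∑ k, l k = m * (q - 1) ∧
        (∀ i, l (.inl i) < q) ∧ ∃ j, q ≤ l (.inr j)}.ncard := by
  have hcompl (r : Fin m → ℕ) (hr : ∀ i, r i ≤ q - 1) :
      ∑ i, (q - 1 - r i) + ∑ i, r i = m * (q - 1) := by
    rw [← sum_add_distrib, sum_congr rfl fun i _ => Nat.sub_add_cancel (hr i)]
    simp
  refine Set.ncard_congr
    (fun p _ => Sum.elim (fun i => q - 1 - ∑ j, p i j) (fun j => ∑ i, p i j)) ?_ ?_ ?_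
  · rintro p ⟨-, hrow, hcol⟩
    refine ⟨?_, fun i => ?_, hcol⟩
    · simp only [Fintype.sum_sum_type, Sum.elim_inl, Sum.elim_inr]
      rw [sum_comm (f := fun j i => p i j), hcompl _ hrow]
    · simp only [Sum.elim_inl]
      omega
  · rintro p p' ⟨hp, hrow, -⟩ ⟨hp', hrow', -⟩ h
    refine hp.ext_of_sums hp' (fun i => ?_) fun j => congrFun h (.inr j)
    have h1 := congrFun h (.inl i)
    have h2 := hrow i
    have h3 := hrow' i
    simp only [Sum.elim_inl] at h1
    omega
  · rintro l ⟨hsum, hrow, hcol⟩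
    have h1 := hcompl (fun i => l (.inl i)) fun i => Nat.le_sub_one_of_lt (hrow i)
    rw [Fintype.sum_sum_type] at hsum
    obtain ⟨p, hp, hr, hc⟩ := exists_isStaircase (fun i => q - 1 - l (.inl i))
      (fun j => l (.inr j)) (by omega)
    refine ⟨p, ⟨hp, fun i => by rw [hr]; omega, ?_⟩, ?_⟩
    · simpa only [hc] using hcol
    · ext (i | j)
      · simp only [Sum.elim_inl, hr]
        have := hrow i
        omega
      · simp only [Sum.elim_inr, hc]

open PowerSeries in
lemma mk_lt_eq (q : ℕ) :
    (mk fun a => if a < q then (1 : ℤ) else 0) = (1 - X ^ q) * PowerSeries.mk 1 := by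
  ext a
  rw [sub_mul, one_mul, map_sub, coeff_X_pow_mul']
  simp only [coeff_mk, Pi.one_apply]
  grind

open PowerSeries in
lemma ncard_eq_coeff (m n q d : ℕ) :
    (({l : Fin m ⊕ Fin n → ℕ | ∑ k, l k = d ∧
        (∀ i, l (.inl i) < q) ∧ ∃ j, q ≤ l (.inr j)}.ncard : ℕ) : ℤ) =
      coeff d ((1 - X ^ q) ^ m * (1 - (1 - X ^ q) ^ n) *
        (PowerSeries.mk 1 : PowerSeries ℤ) ^ (m + n)) := by
  have hdiff : {l : Fin m ⊕ Fin n → ℕ | ∑ k, l k = d ∧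
        (∀ i, l (.inl i) < q) ∧ ∃ j, q ≤ l (.inr j)} =
      {l | ∑ k, l k = d ∧ ∀ k, k.isLeft → l k < q} \ {l | ∑ k, l k = d ∧ ∀ k, l k < q} := by
    ext l
    simp only [Set.mem_sdiff, Set.mem_ofPred_eq, Sum.forall, Sum.isLeft_inl, Sum.isLeft_inr,
      forall_const]
    push Not
    grind
  have hsub : {l : Fin m ⊕ Fin n → ℕ | ∑ k, l k = d ∧ ∀ k, l k < q} ⊆
      {l | ∑ k, l k = d ∧ ∀ k, k.isLeft → l k < q} := fun l hl => ⟨hl.1, fun k _ => hl.2 k⟩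
  rw [hdiff, Set.ncard_sdiff hsub (finite_sum_eq d _),
    Nat.cast_sub (Set.ncard_le_ncard hsub (finite_sum_eq d _)),
    ncard_sum_eq_coeff_prod (fun (k : Fin m ⊕ Fin n) (a : ℕ) => k.isLeft → a < q),
    ncard_sum_eq_coeff_prod (fun (_ : Fin m ⊕ Fin n) (a : ℕ) => a < q), ← map_sub]
  congr 1
  have h1 : (mk fun _ => (1 : ℤ)) = PowerSeries.mk 1 := rfl
  simp only [Fintype.prod_sum_type, Sum.isLeft_inl, Sum.isLeft_inr, true_imp_iff,
    Bool.false_eq_true, false_imp_iff, if_true, mk_lt_eq, h1, prod_const, card_univ,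
    Fintype.card_fin, Fintype.card_sum, mul_pow]
  ring

open PowerSeries in
lemma coeff_X_pow_mul_mk_one_pow (m n q i j : ℕ) (hm : 0 < m) (hq : 0 < q) (hj : j ≤ m) :
    coeff (m * (q - 1)) (X ^ (q * (m - j + i)) * (PowerSeries.mk 1 : PowerSeries ℤ) ^ (m + n)) =
      ichoose ((j : ℤ) * q - (i : ℤ) * q + n - 1) (m + n - 1) := by
  obtain ⟨k, rfl⟩ := Nat.exists_eq_add_of_le hj
  obtain ⟨q, rfl⟩ := Nat.exists_eq_succ_of_ne_zero hq.ne'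
  obtain ⟨d, hd⟩ := Nat.exists_eq_succ_of_ne_zero (show j + k + n ≠ 0 by omega)
  rw [coeff_X_pow_mul', hd, Nat.succ_eq_add_one, mk_one_pow_eq_mk_choose_add, coeff_mk]
  simp only [Nat.add_sub_cancel_left, Nat.succ_eq_add_one, Nat.add_sub_cancel]
  have key : (j : ℤ) * (q + 1 : ℕ) - (i : ℤ) * (q + 1 : ℕ) + n - 1 =
      d + (((j + k) * q : ℕ) - ((q + 1) * (k + i) : ℕ)) := by
    have : (j : ℤ) + k + n = d + 1 := by exact_mod_cast hd
    push_cast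
    linear_combination this
  rw [ichoose, key]
  split_ifs with h1 h2 h2
  · omega
  · congr 2
    omega
  · rfl
  · omega

lemma sum_range_succ_eq_add_sum_Icc {M : Type*} [AddCommMonoid M] (f : ℕ → M) (n : ℕ) :
    ∑ k ∈ range (n + 1), f k = f 0 + ∑ k ∈ Icc 1 n, f k := by
  rw [range_eq_Ico, sum_eq_sum_Ico_succ_bot n.succ_pos, zero_add]
  rfl

open PowerSeries in
lemma one_sub_X_pow_pow (m q : ℕ) : (1 - X ^ q : PowerSeries ℤ) ^ m =
    ∑ j ∈ range (m + 1), C ((-1) ^ (m - j) * (m.choose j : ℤ)) * X ^ (q * (m - j)) := by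
  rw [sub_eq_add_neg, add_pow]
  refine sum_congr rfl fun j _ => ?_
  rw [neg_pow, pow_mul]
  simp
  ring

open PowerSeries in
lemma one_sub_one_sub_X_pow_pow (n q : ℕ) : 1 - (1 - X ^ q : PowerSeries ℤ) ^ n =
    ∑ i ∈ Icc 1 n, C ((-1) ^ (i - 1) * (n.choose i : ℤ)) * X ^ (q * i) := by
  rw [sub_eq_add_neg (1 : PowerSeries ℤ) (X ^ q), add_comm 1 (-X ^ q), add_pow,
    sum_range_succ_eq_add_sum_Icc]
  simp only [pow_zero, one_pow, Nat.choose_zero_right, Nat.cast_one, mul_one, sub_add_cancel_left,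
    ← sum_neg_distrib]
  refine sum_congr rfl fun i hi => ?_
  obtain ⟨i, rfl⟩ := Nat.exists_eq_add_of_le' (mem_Icc.1 hi).1
  rw [neg_pow, pow_mul, Nat.add_sub_cancel, pow_succ (-1)]
  simp
  ring

end

theorem stmt_8 (m n q : ℕ) (hm : 0 < m) (hn : 0 < n) (hq : 0 < q) :
    ((Set.ncard {p : Fin m → Fin n → ℕ |
        IsStaircase p ∧ (∀ i : Fin m, ∑ j, p i j ≤ q - 1) ∧
          ∃ j : Fin n, q ≤ ∑ i, p i j} : ℕ) : ℤ)
      = ∑ i ∈ Finset.Icc 1 n, ∑ j ∈ Finset.Icc 1 m,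
          (-1 : ℤ) ^ (m - j + i - 1) * (n.choose i : ℤ) * (m.choose j : ℤ) *
            ichoose ((j : ℤ) * q - (i : ℤ) * q + n - 1) (m + n - 1) := by
  rw [ncard_staircase_eq m n q hq, ncard_eq_coeff, one_sub_X_pow_pow, one_sub_one_sub_X_pow_pow,
    Finset.sum_mul_sum, Finset.sum_comm, Finset.sum_mul, map_sum]
  refine Finset.sum_congr rfl fun i hi => ?_
  have hi1 := (Finset.mem_Icc.1 hi).1
  have hterm : ∀ j ∈ Finset.range (m + 1), PowerSeries.coeff (m * (q - 1))
      (PowerSeries.C ((-1) ^ (m - j) * (m.choose j : ℤ)) * PowerSeries.X ^ (q * (m - j)) *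
        (PowerSeries.C ((-1) ^ (i - 1) * (n.choose i : ℤ)) * PowerSeries.X ^ (q * i)) *
        PowerSeries.mk 1 ^ (m + n)) =
      (-1 : ℤ) ^ (m - j + i - 1) * (n.choose i : ℤ) * (m.choose j : ℤ) *
        ichoose ((j : ℤ) * q - (i : ℤ) * q + n - 1) (m + n - 1) := by
    intro j hj
    rw [← coeff_X_pow_mul_mk_one_pow m n q i j hm hq (Finset.mem_range_succ_iff.1 hj),
      ← PowerSeries.coeff_C_mul, Nat.add_sub_assoc hi1]
    congr 1
    simp only [map_mul, pow_add, mul_add]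
    ring
  have hzero : ichoose (((0 : ℕ) : ℤ) * q - (i : ℤ) * q + n - 1) (m + n - 1) = 0 := by
    have : (0 : ℤ) ≤ (i : ℤ) * q := by positivity
    exact if_pos (by push_cast [show 1 ≤ m + n by omega]; omega)
  rw [Finset.sum_mul, map_sum, Finset.sum_congr rfl hterm, sum_range_succ_eq_add_sum_Icc, hzero,
    mul_zero, zero_add]
end

section
/- Let $m, n, q$ be positive integers. The number of staircase $m \times n$ matrices $(p_{i,j})$ of non-negative integers such that either $\sum_{j=1}^n p_{i,j} < q$ for every row index $i \in \{1,\dots,m\}$, or $\sum_{i=1}^m p_{i,j} < q$ for every column index $j \in \{1,\dots,n\}$, equals $\sum_{i=1}^{n} (-1)^{n-i}\binom{n}{i}\binom{iq + m - 1}{m+n-1} \; + \; \sum_{i=1}^{n}\sum_{j=1}^{m} (-1)^{m-j+i-1}\binom{n}{i}\binom{m}{j}\binom{jq - iq + n - 1}{m+n-1}$. -/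
open Finset

section Margins

/-- Extension of a function on `Fin n` by zero to all naturals. -/
def extendZero {n : ℕ} {α : Type*} [Zero α] (c : Fin n → α) (k : ℕ) : α :=
  if h : k < n then c ⟨k, h⟩ else 0

lemma extendZero_coe {n : ℕ} {α : Type*} [Zero α] (c : Fin n → α) (k : Fin n) :
    extendZero c k = c k := by
  simp [extendZero]

/-- The partial sums of a vector. -/
def partialSum {n : ℕ} (c : Fin n → ℕ) (k : ℕ) : ℕ := ∑ j ∈ range k, extendZero c j

lemma partialSum_zero {n : ℕ} (c : Fin n → ℕ) : partialSum c 0 = 0 := by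
  simp [partialSum]

lemma partialSum_top {n : ℕ} (c : Fin n → ℕ) : partialSum c n = ∑ j, c j := by
  simp [partialSum, Finset.sum_range, extendZero_coe]

lemma partialSum_succ {n : ℕ} (c : Fin n → ℕ) (k : Fin n) :
    partialSum c (k + 1) = partialSum c k + c k := by
  simp [partialSum, Finset.sum_range_succ, extendZero_coe]

lemma partialSum_mono {n : ℕ} (c : Fin n → ℕ) : Monotone (partialSum c) :=
  fun _ _ h => Finset.sum_le_sum_of_subset (Finset.range_mono h)

lemma sum_card_inter_Ico (A : Finset ℕ) (f : ℕ → ℕ) (hf : Monotone f) (n : ℕ) :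
    ∑ j ∈ range n, #(A ∩ Ico (f j) (f (j + 1))) = #(A ∩ Ico (f 0) (f n)) := by
  induction n with
  | zero => simp
  | succ n ih =>
    rw [Finset.sum_range_succ, ih, ← Finset.card_union_of_disjoint, ← Finset.inter_union_distrib_left,
      Finset.Ico_union_Ico_eq_Ico (hf (Nat.zero_le _)) (hf (Nat.le_succ _))]
    refine Disjoint.mono inter_subset_right inter_subset_right ?_
    exact Finset.Ico_disjoint_Ico_consecutive _ _ _

/-- The staircase matrix with prescribed row sums `r` and column sums `c`. -/
def cornerMatrix {m n : ℕ} (r : Fin m → ℕ) (c : Fin n → ℕ) (i : Fin m) (j : Fin n) : ℕ :=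
  #(Ico (partialSum r i) (partialSum r (i + 1)) ∩ Ico (partialSum c j) (partialSum c (j + 1)))

lemma cornerMatrix_comm {m n : ℕ} (r : Fin m → ℕ) (c : Fin n → ℕ) (i : Fin m) (j : Fin n) :
    cornerMatrix r c i j = cornerMatrix c r j i := by
  rw [cornerMatrix, cornerMatrix, inter_comm]

lemma isStaircase_cornerMatrix {m n : ℕ} (r : Fin m → ℕ) (c : Fin n → ℕ) :
    IsStaircase (cornerMatrix r c) := by
  intro i i' j j' hpos hi hj
  obtain ⟨x, hx⟩ := Finset.card_pos.1 hpos
  by_contra h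
  obtain ⟨y, hy⟩ := Finset.card_pos.1 (Nat.pos_of_ne_zero h)
  simp only [mem_inter, mem_Ico] at hx hy
  have h1 : partialSum r (i' + 1) ≤ partialSum r i := partialSum_mono r hi
  have h2 : partialSum c (j + 1) ≤ partialSum c j' := partialSum_mono c hj
  omega

lemma sum_cornerMatrix_row {m n : ℕ} (r : Fin m → ℕ) (c : Fin n → ℕ)
    (h : ∑ i, r i = ∑ j, c j) (i : Fin m) : ∑ j, cornerMatrix r c i j = r i := by
  have := sum_card_inter_Ico (Ico (partialSum r i) (partialSum r (i + 1))) (partialSum c)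
    (partialSum_mono c) n
  rw [Finset.sum_range, partialSum_zero, partialSum_top, ← h, ← partialSum_top r,
    inter_eq_left.2] at this
  · simp only [cornerMatrix]
    rw [this, Nat.card_Ico, partialSum_succ]
    omega
  · exact Ico_subset_Ico (Nat.zero_le _) (partialSum_mono r i.2)

lemma sum_cornerMatrix_col {m n : ℕ} (r : Fin m → ℕ) (c : Fin n → ℕ)
    (h : ∑ i, r i = ∑ j, c j) (j : Fin n) : ∑ i, cornerMatrix r c i j = c j := by
  simp only [cornerMatrix_comm r c]
  exact sum_cornerMatrix_row c r h.symm j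

/-- The sum of the entries of `p` in the first `a` rows and the first `b` columns. -/
def rectSum {m n : ℕ} (p : Fin m → Fin n → ℕ) (a b : ℕ) : ℕ :=
  ∑ i ∈ range a, ∑ j ∈ range b, extendZero (extendZero p i) j

lemma rectSum_full_right {m n : ℕ} (p : Fin m → Fin n → ℕ) (a : ℕ) :
    rectSum p a n = partialSum (fun i => ∑ j, p i j) a := by
  refine Finset.sum_congr rfl fun i _ => ?_
  rw [Finset.sum_range]
  simp only [extendZero_coe]
  unfold extendZero
  split_ifs <;> simp

lemma rectSum_full_left {m n : ℕ} (p : Fin m → Fin n → ℕ) (b : ℕ) :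
    rectSum p m b = partialSum (fun j => ∑ i, p i j) b := by
  rw [rectSum, Finset.sum_comm]
  refine Finset.sum_congr rfl fun j _ => ?_
  rw [Finset.sum_range]
  simp only [extendZero_coe]
  unfold extendZero
  split_ifs <;> simp

lemma extendZero_extendZero_ne_zero {m n : ℕ} {p : Fin m → Fin n → ℕ} {i j : ℕ}
    (h : extendZero (extendZero p i) j ≠ 0) : ∃ (hi : i < m) (hj : j < n),
      0 < p ⟨i, hi⟩ ⟨j, hj⟩ := by
  unfold extendZero at h
  by_cases hj : j < n <;> by_cases hi : i < m <;> simp [hi, hj] at h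
  exact ⟨hi, hj, Nat.pos_of_ne_zero h⟩

lemma IsStaircase.rectSum_eq_min {m n : ℕ} {p : Fin m → Fin n → ℕ} (hp : IsStaircase p)
    {a b : ℕ} (ha : a ≤ m) (hb : b ≤ n) :
    rectSum p a b = min (rectSum p a n) (rectSum p m b) := by
  have h1 : rectSum p a n = rectSum p a b +
      ∑ i ∈ range a, ∑ j ∈ Ico b n, extendZero (extendZero p i) j := by
    rw [rectSum, rectSum, ← Finset.sum_add_distrib]
    exact Finset.sum_congr rfl fun i _ => (Finset.sum_range_add_sum_Ico _ hb).symm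
  have h2 : rectSum p m b = rectSum p a b +
      ∑ i ∈ Ico a m, ∑ j ∈ range b, extendZero (extendZero p i) j :=
    (Finset.sum_range_add_sum_Ico _ ha).symm
  have h3 : ∑ i ∈ range a, ∑ j ∈ Ico b n, extendZero (extendZero p i) j = 0 ∨
      ∑ i ∈ Ico a m, ∑ j ∈ range b, extendZero (extendZero p i) j = 0 := by
    by_contra! h
    obtain ⟨i', hi', h'⟩ := Finset.exists_ne_zero_of_sum_ne_zero h.1
    obtain ⟨j', hj', h'⟩ := Finset.exists_ne_zero_of_sum_ne_zero h'
    obtain ⟨i, hi, h⟩ := Finset.exists_ne_zero_of_sum_ne_zero h.2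
    obtain ⟨j, hj, h⟩ := Finset.exists_ne_zero_of_sum_ne_zero h
    obtain ⟨_, _, h'⟩ := extendZero_extendZero_ne_zero h'
    obtain ⟨_, _, h⟩ := extendZero_extendZero_ne_zero h
    simp only [mem_range, mem_Ico] at hi hj hi' hj'
    refine h'.ne' (hp _ _ _ _ h ?_ ?_) <;> rw [Fin.mk_lt_mk] <;> omega
  omega

lemma IsStaircase.eq_of_margins_eq {m n : ℕ} {p p' : Fin m → Fin n → ℕ} (hp : IsStaircase p)
    (hp' : IsStaircase p') (hr : ∀ i, ∑ j, p i j = ∑ j, p' i j)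
    (hc : ∀ j, ∑ i, p i j = ∑ i, p' i j) : p = p' := by
  have key : ∀ a b, a ≤ m → b ≤ n → rectSum p a b = rectSum p' a b := by
    intro a b ha hb
    rw [hp.rectSum_eq_min ha hb, hp'.rectSum_eq_min ha hb, rectSum_full_right, rectSum_full_right,
      rectSum_full_left, rectSum_full_left, funext hr, funext hc]
  have corner : ∀ (x : Fin m → Fin n → ℕ) (i : Fin m) (j : Fin n),
      rectSum x (i + 1) (j + 1) + rectSum x i j
        = rectSum x (i + 1) j + rectSum x i (j + 1) + x i j := by
    intro x i j
    simp only [rectSum, Finset.sum_range_succ, extendZero_coe]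
    ring
  ext i j
  have h1 := corner p i j
  have h2 := corner p' i j
  rw [key (i + 1) (j + 1) i.2 j.2, key i j i.2.le j.2.le, key (i + 1) j i.2 j.2.le,
    key i (j + 1) i.2.le j.2] at h1
  omega

/-- Staircase matrices are counted by their pairs of margins. -/
lemma ncard_staircase_eq_ncard_margins (m n : ℕ) (Q : (Fin m → ℕ) → (Fin n → ℕ) → Prop) :
    Set.ncard {p : Fin m → Fin n → ℕ |
        IsStaircase p ∧ Q (fun i => ∑ j, p i j) (fun j => ∑ i, p i j)} =
      Set.ncard {x : (Fin m → ℕ) × (Fin n → ℕ) | ∑ i, x.1 i = ∑ j, x.2 j ∧ Q x.1 x.2} := by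
  refine Set.ncard_congr (fun p _ => (fun i => ∑ j, p i j, fun j => ∑ i, p i j)) ?_ ?_ ?_
  · rintro p ⟨_, h⟩
    exact ⟨by dsimp only; exact Finset.sum_comm, h⟩
  · rintro p p' ⟨hp, _⟩ ⟨hp', _⟩ h
    rw [Prod.mk.injEq] at h
    exact hp.eq_of_margins_eq hp' (congrFun h.1) (congrFun h.2)
  · rintro ⟨r, c⟩ ⟨h, hQ⟩
    have hr := funext (sum_cornerMatrix_row r c h)
    have hc := funext (sum_cornerMatrix_col r c h)
    exact ⟨cornerMatrix r c, ⟨isStaircase_cornerMatrix r c, by rwa [hr, hc]⟩, by rw [hr, hc]⟩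

end Margins

section Counting

lemma ichoose_of_lt {t : ℤ} {k : ℕ} (h : t < k) : ichoose t k = 0 := if_pos h

lemma ichoose_natCast (a b : ℕ) : ichoose (a : ℤ) b = (a.choose b : ℕ) := by
  unfold ichoose
  split_ifs with hab
  · rw [Nat.choose_eq_zero_of_lt (by exact_mod_cast hab), Nat.cast_zero]
  · simp

lemma ichoose_succ_succ (t : ℤ) (k : ℕ) :
    ichoose (t + 1) (k + 1) = ichoose t k + ichoose t (k + 1) := by
  rcases lt_or_ge t 0 with h | h
  · rw [ichoose_of_lt (by push_cast; omega), ichoose_of_lt (by omega),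
      ichoose_of_lt (by push_cast; omega), add_zero]
  · lift t to ℕ using h
    rw [← Nat.cast_succ]
    simp only [ichoose_natCast, Nat.succ_eq_add_one, Nat.choose_succ_succ]
    push_cast
    rfl

lemma sum_ichoose (q k : ℕ) (t : ℤ) :
    ∑ x : Fin q, ichoose ((x : ℕ) + t) k = ichoose (t + q) (k + 1) - ichoose t (k + 1) := by
  rw [← Finset.sum_range (fun x => ichoose ((x : ℕ) + t) k)]
  induction q with
  | zero => simp
  | succ q ih =>
    rw [Finset.sum_range_succ, ih]
    have := ichoose_succ_succ (t + q) k
    push_cast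
    rw [← add_assoc, this, add_comm (q : ℤ) t]
    ring

lemma sum_box_ichoose_eq_fwdDiff (m q k : ℕ) (t : ℤ) :
    ∑ r : Fin m → Fin q, ichoose ((∑ i, (r i : ℕ) : ℕ) + t) k =
      (fwdDiff (q : ℤ))^[m] (fun s => ichoose s (k + m)) t := by
  induction m generalizing k t with
  | zero => simp
  | succ m ih =>
    rw [← (Fin.consEquiv fun _ => Fin q).sum_comp, Fintype.sum_prod_type, Finset.sum_comm]
    simp only [Fin.consEquiv, Equiv.coe_fn_mk, Fin.sum_univ_succ, Fin.cons_zero, Fin.cons_succ]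
    have : ∀ r : Fin m → Fin q,
        ∑ x : Fin q, ichoose (((x : ℕ) + ∑ i, (r i : ℕ) : ℕ) + t) k =
          ichoose ((∑ i, (r i : ℕ) : ℕ) + (t + q)) (k + 1) -
            ichoose ((∑ i, (r i : ℕ) : ℕ) + t) (k + 1) := by
      intro r
      rw [← add_assoc, ← sum_ichoose]
      refine Finset.sum_congr rfl fun x _ => ?_
      push_cast
      rw [add_assoc]
    rw [Finset.sum_congr rfl fun r _ => this r, Finset.sum_sub_distrib, ih, ih,
      Function.iterate_succ_apply', fwdDiff, add_right_comm k 1 m, add_assoc k m 1]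

lemma sum_box_ichoose (m q k : ℕ) (t : ℤ) :
    ∑ r : Fin m → Fin q, ichoose ((∑ i, (r i : ℕ) : ℕ) + t) k =
      ∑ j ∈ range (m + 1), (-1 : ℤ) ^ (m - j) * (m.choose j : ℤ) * ichoose (j * q + t) (k + m) := by
  rw [sum_box_ichoose_eq_fwdDiff, fwdDiff_iter_eq_sum_shift]
  refine Finset.sum_congr rfl fun j _ => ?_
  rw [smul_eq_mul, nsmul_eq_mul, add_comm t]

lemma range_succ_eq_insert_Icc (m : ℕ) : range (m + 1) = insert 0 (Icc 1 m) := by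
  ext x
  simp only [mem_range, mem_insert, mem_Icc]
  omega

lemma sum_box_ichoose_of_lt (m q k : ℕ) (t : ℤ) (ht : t < (k + m : ℕ)) :
    ∑ r : Fin m → Fin q, ichoose ((∑ i, (r i : ℕ) : ℕ) + t) k =
      ∑ j ∈ Icc 1 m, (-1 : ℤ) ^ (m - j) * (m.choose j : ℤ) * ichoose (j * q + t) (k + m) := by
  rw [sum_box_ichoose, range_succ_eq_insert_Icc, Finset.sum_insert (by simp)]
  simp [ichoose_of_lt ht]

lemma card_piAntidiag_fin (n s : ℕ) (hn : 0 < n) :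
    (#(piAntidiag (univ : Finset (Fin n)) s) : ℤ) = ichoose ((s : ℤ) + n - 1) (n - 1) := by
  have h : ((s : ℤ) + n - 1) = ((s + n - 1 : ℕ) : ℤ) := by omega
  rw [← map_sym_eq_piAntidiag, card_map, sym_univ, card_univ, Sym.card_sym_eq_choose,
    Fintype.card_fin, h, ichoose_natCast, add_comm n s]
  congr 1
  rw [← Nat.choose_symm (by omega)]
  congr 1
  omega

lemma card_piAntidiag_filter_ge (n s q : ℕ) (hn : 0 < n) (S : Finset (Fin n)) :
    (#{c ∈ piAntidiag (univ : Finset (Fin n)) s | ∀ j ∈ S, q ≤ c j} : ℤ) =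
      ichoose ((s : ℤ) - #S * q + n - 1) (n - 1) := by
  have hsum : ∑ j : Fin n, (if j ∈ S then q else 0) = #S * q := by simp
  by_cases hs : #S * q ≤ s
  · have h : ((s : ℤ) - #S * q + n - 1) = ((s - #S * q : ℕ) : ℤ) + n - 1 := by
      push_cast [hs]; ring
    rw [h, ← card_piAntidiag_fin n _ hn]
    congr 1
    refine Finset.card_nbij' (fun c j => c j - if j ∈ S then q else 0)
      (fun c j => c j + if j ∈ S then q else 0) ?_ ?_ ?_ ?_
    · intro c hc
      simp only [coe_filter, mem_piAntidiag, mem_univ, implies_true, and_true,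
        Set.mem_ofPred_eq] at hc
      have hle : ∀ j ∈ (univ : Finset (Fin n)), (if j ∈ S then q else 0) ≤ c j := by
        intro j _
        split_ifs with hj
        exacts [hc.2 j hj, Nat.zero_le _]
      simp only [mem_coe, mem_piAntidiag, mem_univ, implies_true, and_true]
      rw [Finset.sum_tsub_distrib _ hle, hsum, hc.1]
    · intro c hc
      simp only [mem_coe, mem_piAntidiag, mem_univ, implies_true, and_true] at hc
      simp only [coe_filter, mem_piAntidiag, mem_univ, implies_true, and_true,
        Set.mem_ofPred_eq, Finset.sum_add_distrib, hsum, hc]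
      refine ⟨by omega, fun j hj => by simp [hj]⟩
    · intro c hc
      simp only [coe_filter, Set.mem_ofPred_eq] at hc
      ext j
      dsimp only
      split_ifs with hj
      · exact Nat.sub_add_cancel (hc.2 j hj)
      · simp
    · intro c _
      ext j
      simp
  · rw [ichoose_of_lt, Finset.card_eq_zero.2, Nat.cast_zero]
    · refine Finset.filter_eq_empty_iff.2 fun c hc h => hs ?_
      simp only [mem_piAntidiag, mem_univ, implies_true, and_true] at hc
      rw [← hc, ← hsum]
      refine Finset.sum_le_sum fun j _ => ?_
      split_ifs with hj
      exacts [h j hj, Nat.zero_le _]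
    · have : (s : ℤ) < #S * q := by exact_mod_cast not_le.1 hs
      omega

lemma ite_forall_lt_eq_sum {n : ℕ} (c : Fin n → ℕ) (q : ℕ) :
    (if ∀ j, c j < q then (1 : ℤ) else 0) =
      ∑ S : Finset (Fin n), (-1) ^ #S * if ∀ j ∈ S, q ≤ c j then (1 : ℤ) else 0 := by
  have h := Finset.prod_add_one (f := fun j => -(if q ≤ c j then (1 : ℤ) else 0)) univ
  rw [powerset_univ] at h
  calc _ = ∏ j, (-(if q ≤ c j then (1 : ℤ) else 0) + 1) := by
        split_ifs with hc
        · exact (Finset.prod_eq_one fun j _ => by simp [hc j]).symm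
        · push Not at hc
          obtain ⟨j, hj⟩ := hc
          exact (Finset.prod_eq_zero (mem_univ j) (by simp [hj])).symm
    _ = _ := by
        rw [h]
        refine Finset.sum_congr rfl fun S _ => ?_
        rw [Finset.prod_neg, Finset.prod_ite_zero, Finset.prod_const_one]
        congr

lemma card_piAntidiag_filter_lt (n s q : ℕ) (hn : 0 < n) :
    (#{c ∈ piAntidiag (univ : Finset (Fin n)) s | ∀ j, c j < q} : ℤ) =
      ∑ i ∈ range (n + 1), (-1 : ℤ) ^ i * (n.choose i : ℤ) *
        ichoose ((s : ℤ) - i * q + n - 1) (n - 1) := by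
  rw [Finset.natCast_card_filter]
  rw [Finset.sum_congr rfl fun c _ => ite_forall_lt_eq_sum c q, Finset.sum_comm]
  have hS : ∀ S : Finset (Fin n), ∑ c ∈ piAntidiag (univ : Finset (Fin n)) s,
      ((-1 : ℤ) ^ #S * if ∀ j ∈ S, q ≤ c j then (1 : ℤ) else 0) =
        (-1 : ℤ) ^ #S * ichoose ((s : ℤ) - #S * q + n - 1) (n - 1) := by
    intro S
    rw [← Finset.mul_sum, ← card_piAntidiag_filter_ge n s q hn, Finset.natCast_card_filter]
  rw [Finset.sum_congr rfl fun S _ => hS S]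
  have := Finset.sum_powerset_apply_card
    (fun i => (-1 : ℤ) ^ i * ichoose ((s : ℤ) - i * q + n - 1) (n - 1))
    (x := (univ : Finset (Fin n)))
  rw [powerset_univ, card_univ, Fintype.card_fin] at this
  rw [this]
  refine Finset.sum_congr rfl fun i _ => ?_
  rw [nsmul_eq_mul]
  ring

lemma card_piAntidiag_filter_not_lt (n s q : ℕ) (hn : 0 < n) :
    (#{c ∈ piAntidiag (univ : Finset (Fin n)) s | ¬ ∀ j, c j < q} : ℤ) =
      ∑ i ∈ Icc 1 n, (-1 : ℤ) ^ (i - 1) * (n.choose i : ℤ) *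
        ichoose ((s : ℤ) - i * q + n - 1) (n - 1) := by
  have h1 := Finset.card_filter_add_card_filter_not (s := piAntidiag (univ : Finset (Fin n)) s)
    (fun c => ∀ j, c j < q)
  have h2 := card_piAntidiag_filter_lt n s q hn
  have h3 := card_piAntidiag_fin n s hn
  rw [range_succ_eq_insert_Icc, Finset.sum_insert (by simp)] at h2
  have h4 : ∑ i ∈ Icc 1 n, (-1 : ℤ) ^ (i - 1) * (n.choose i : ℤ) *
        ichoose ((s : ℤ) - i * q + n - 1) (n - 1) =
      -∑ i ∈ Icc 1 n, (-1 : ℤ) ^ i * (n.choose i : ℤ) *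
        ichoose ((s : ℤ) - i * q + n - 1) (n - 1) := by
    rw [← Finset.sum_neg_distrib]
    refine Finset.sum_congr rfl fun i hi => ?_
    obtain ⟨k, rfl⟩ := Nat.exists_eq_add_of_le' (mem_Icc.1 hi).1
    rw [Nat.add_sub_cancel, pow_succ]
    ring
  rw [h4]
  simp only [Nat.cast_zero, zero_mul, sub_zero, pow_zero, one_mul, Nat.choose_zero_right,
    Nat.cast_one, ← h3] at h2
  have h5 := congrArg (Nat.cast : ℕ → ℤ) h1
  rw [Nat.cast_add] at h5
  linarith

/-- The pairs `(u, v)` with `u` in the box `[0, q)^m`, `v` satisfying `Q`, and equal totals. -/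
lemma ncard_box_pairs (m n q : ℕ) (Q : (Fin n → ℕ) → Prop) [DecidablePred Q] :
    Set.Finite {x : (Fin m → ℕ) × (Fin n → ℕ) |
      ∑ i, x.1 i = ∑ j, x.2 j ∧ (∀ i, x.1 i < q) ∧ Q x.2} ∧
    Set.ncard {x : (Fin m → ℕ) × (Fin n → ℕ) |
      ∑ i, x.1 i = ∑ j, x.2 j ∧ (∀ i, x.1 i < q) ∧ Q x.2} =
      ∑ r : Fin m → Fin q,
        #{c ∈ piAntidiag (univ : Finset (Fin n)) (∑ i, (r i : ℕ)) | Q c} := by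
  let e : (Σ _ : Fin m → Fin q, Fin n → ℕ) ↪ (Fin m → ℕ) × (Fin n → ℕ) :=
    ⟨fun x => (fun i => x.1 i, x.2), by
      rintro ⟨r, c⟩ ⟨r', c'⟩ h
      simp only [Prod.mk.injEq, funext_iff, Fin.val_inj] at h
      rw [funext h.1, funext h.2]⟩
  have h : {x : (Fin m → ℕ) × (Fin n → ℕ) |
      ∑ i, x.1 i = ∑ j, x.2 j ∧ (∀ i, x.1 i < q) ∧ Q x.2} =
      ((univ : Finset (Fin m → Fin q)).sigma fun r =>
        {c ∈ piAntidiag (univ : Finset (Fin n)) (∑ i, (r i : ℕ)) | Q c}).map e := by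
    ext ⟨r, c⟩
    simp only [Set.mem_ofPred_eq, mem_coe, mem_map, mem_sigma, mem_univ, true_and, mem_filter,
      mem_piAntidiag, implies_true, and_true]
    constructor
    · rintro ⟨h, hr, hQ⟩
      exact ⟨⟨fun i => ⟨r i, hr i⟩, c⟩, ⟨h.symm, hQ⟩, rfl⟩
    · rintro ⟨⟨r', c'⟩, ⟨h, hQ⟩, heq⟩
      obtain ⟨rfl, rfl⟩ := Prod.mk.inj heq
      exact ⟨h.symm, fun i => (r' i).2, hQ⟩
  rw [h]
  exact ⟨Finset.finite_toSet _, by rw [Set.ncard_coe_finset, card_map, card_sigma]⟩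

lemma ncard_box_pairs_true (m n q : ℕ) (hm : 0 < m) (hn : 0 < n) :
    (Set.ncard {x : (Fin n → ℕ) × (Fin m → ℕ) |
      ∑ i, x.1 i = ∑ j, x.2 j ∧ (∀ i, x.1 i < q) ∧ True} : ℤ) =
    ∑ i ∈ Icc 1 n, (-1 : ℤ) ^ (n - i) * (n.choose i : ℤ) *
          ichoose ((i : ℤ) * q + m - 1) (m + n - 1) := by
  rw [(ncard_box_pairs n m q fun _ => True).2]
  push_cast
  simp only [filter_true, card_piAntidiag_fin m _ hm, add_sub_assoc]
  have := sum_box_ichoose_of_lt n q (m - 1) ((m : ℤ) - 1) (by omega)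
  rw [show m - 1 + n = m + n - 1 by omega] at this
  exact_mod_cast this

lemma ncard_box_pairs_not_lt (m n q : ℕ) (hm : 0 < m) (hn : 0 < n) :
    (Set.ncard {x : (Fin m → ℕ) × (Fin n → ℕ) |
      ∑ i, x.1 i = ∑ j, x.2 j ∧ (∀ i, x.1 i < q) ∧ ¬ ∀ j, x.2 j < q} : ℤ) =
    ∑ i ∈ Icc 1 n, ∑ j ∈ Icc 1 m,
            (-1 : ℤ) ^ (m - j + i - 1) * (n.choose i : ℤ) * (m.choose j : ℤ) *
              ichoose ((j : ℤ) * q - (i : ℤ) * q + n - 1) (m + n - 1) := by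
  rw [(ncard_box_pairs m n q fun c => ¬ ∀ j, c j < q).2, Nat.cast_sum]
  simp only [card_piAntidiag_filter_not_lt n _ q hn]
  rw [Finset.sum_comm]
  refine Finset.sum_congr rfl fun i hi => ?_
  rw [← Finset.mul_sum]
  have h := sum_box_ichoose_of_lt m q (n - 1) (-((i : ℤ) * q) + n - 1) (by
    have : (0 : ℤ) ≤ i * q := by positivity
    omega)
  have hs : ∀ x : ℤ, x - i * q + n - 1 = x + (-((i : ℤ) * q) + n - 1) := fun x => by ring
  simp only [hs]
  rw [h, Finset.mul_sum]
  refine Finset.sum_congr rfl fun j _ => ?_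
  rw [show n - 1 + m = m + n - 1 by omega,
    show m - j + i - 1 = (m - j) + (i - 1) by have := (mem_Icc.1 hi).1; omega, pow_add]
  ring

end Counting

theorem stmt_9 (m n q : ℕ) (hm : 0 < m) (hn : 0 < n) (hq : 0 < q) :
    ((Set.ncard {p : Fin m → Fin n → ℕ |
        IsStaircase p ∧
          ((∀ i : Fin m, ∑ j, p i j < q) ∨ (∀ j : Fin n, ∑ i, p i j < q))} : ℕ) : ℤ)
      = (∑ i ∈ Finset.Icc 1 n, (-1 : ℤ) ^ (n - i) * (n.choose i : ℤ) *
          ichoose ((i : ℤ) * q + m - 1) (m + n - 1))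
        + ∑ i ∈ Finset.Icc 1 n, ∑ j ∈ Finset.Icc 1 m,
            (-1 : ℤ) ^ (m - j + i - 1) * (n.choose i : ℤ) * (m.choose j : ℤ) *
              ichoose ((j : ℤ) * q - (i : ℤ) * q + n - 1) (m + n - 1) := by
  rw [ncard_staircase_eq_ncard_margins m n fun r c => (∀ i, r i < q) ∨ ∀ j, c j < q]
  rw [← ncard_box_pairs_true m n q hm hn, ← ncard_box_pairs_not_lt m n q hm hn]
  have hA := (ncard_box_pairs n m q fun _ => True).1
  have hB := (ncard_box_pairs m n q fun c => ¬ ∀ j, c j < q).1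
  set A := {x : (Fin n → ℕ) × (Fin m → ℕ) |
      ∑ i, x.1 i = ∑ j, x.2 j ∧ (∀ i, x.1 i < q) ∧ True}
  set B := {x : (Fin m → ℕ) × (Fin n → ℕ) |
      ∑ i, x.1 i = ∑ j, x.2 j ∧ (∀ i, x.1 i < q) ∧ ¬ ∀ j, x.2 j < q}
  have hunion : {x : (Fin m → ℕ) × (Fin n → ℕ) | ∑ i, x.1 i = ∑ j, x.2 j ∧
      ((∀ i, x.1 i < q) ∨ ∀ j, x.2 j < q)} = Prod.swap '' A ∪ B := by
    ext ⟨r, c⟩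
    simp only [A, B, Set.image_swap_eq_preimage_swap, Set.mem_ofPred_eq, Set.mem_union,
      Set.mem_preimage, Prod.swap_prod_mk, and_true, eq_comm (a := ∑ j, c j)]
    tauto
  have hdisj : Disjoint (Prod.swap '' A) B := by
    rw [Set.image_swap_eq_preimage_swap, Set.disjoint_left]
    exact fun x hx hx' => hx'.2.2 hx.2.1
  rw [hunion, Set.ncard_union_eq hdisj (hA.image _) hB,
    Set.ncard_image_of_injective _ Prod.swap_injective, Nat.cast_add]
end
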